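/- Let Z_1 and Z_2 be i.i.d. random variables uniformly distributed on [0,1], and let Y_1 and Y_2 be independent [0,1]-valued random variables whose cumulative distribution functions satisfy (F_{Y_1}(x) + F_{Y_2}(x))/2 = x for all x ∈ [0,1]. Then E ∫_0^1 ((1_{Y_1 ≤ x} + 1_{Y_2 ≤ x})/2 − x)² dx ≤ E ∫_0^1 ((1_{Z_1 ≤ x} + 1_{Z_2 ≤ x})/2 − x)² dx, i.e. E L2²({Y_1,Y_2}) ≤ E L2²({Z_1,Z_2}). -/

import Mathlib

open MeasureTheory ProbabilityTheory

noncomputable section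

/-- Mean squared L2-discrepancy of the random two-point set `{W₁, W₂}` in `[0,1]`:
`E ∫₀¹ ((1_{W₁ ≤ x} + 1_{W₂ ≤ x})/2 − x)² dx`. -/
def meanL2sqPair {Ω : Type*} [MeasurableSpace Ω] (P : Measure Ω) (W₁ W₂ : Ω → ℝ) : ℝ :=
  ∫ ω, (∫ x in Set.Icc (0 : ℝ) 1,
      (((if W₁ ω ≤ x then (1 : ℝ) else 0) + (if W₂ ω ≤ x then (1 : ℝ) else 0)) / 2 - x) ^ 2)
    ∂P

/-- The squared local discrepancy `((1_{u ≤ x} + 1_{v ≤ x})/2 − x)²` of the pair `{u, v}` at `x`. -/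
def sqLocalDiscrepancy (u v x : ℝ) : ℝ :=
  (((if u ≤ x then (1 : ℝ) else 0) + (if v ≤ x then (1 : ℝ) else 0)) / 2 - x) ^ 2

lemma integrable_sqLocalDiscrepancy {Ω : Type*} [MeasurableSpace Ω]
    (P : Measure Ω) [IsFiniteMeasure P] {U V : Ω → ℝ} (hU : Measurable U) (hV : Measurable V) :
    Integrable (fun p : Ω × ℝ => sqLocalDiscrepancy (U p.1) (V p.1) p.2)
      (P.prod (volume.restrict (Set.Icc (0 : ℝ) 1))) := by
  have hmeas : Measurable (fun p : Ω × ℝ => sqLocalDiscrepancy (U p.1) (V p.1) p.2) := by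
    have h₁ : MeasurableSet {p : Ω × ℝ | U p.1 ≤ p.2} :=
      measurableSet_le (hU.comp measurable_fst) measurable_snd
    have h₂ : MeasurableSet {p : Ω × ℝ | V p.1 ≤ p.2} :=
      measurableSet_le (hV.comp measurable_fst) measurable_snd
    exact ((((measurable_const.ite h₁ measurable_const).add
      (measurable_const.ite h₂ measurable_const)).div_const 2).sub measurable_snd).pow_const 2
  refine Integrable.of_bound hmeas.aestronglyMeasurable 1 ?_
  have hx : ∀ᵐ p ∂(P.prod (volume.restrict (Set.Icc (0 : ℝ) 1))), p.2 ∈ Set.Icc (0 : ℝ) 1 :=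
    Measure.quasiMeasurePreserving_snd.ae (ae_restrict_mem measurableSet_Icc)
  filter_upwards [hx] with p ⟨h0, h1⟩
  rw [sqLocalDiscrepancy, Real.norm_eq_abs, abs_of_nonneg (sq_nonneg _), sq_le_one_iff_abs_le_one,
    abs_le]
  split_ifs <;> constructor <;> linarith

lemma meanL2sqPair_eq_setIntegral_integral {Ω : Type*} [MeasurableSpace Ω]
    (P : Measure Ω) [IsFiniteMeasure P] {U V : Ω → ℝ} (hU : Measurable U) (hV : Measurable V) :
    meanL2sqPair P U V =
      ∫ x in Set.Icc (0 : ℝ) 1, ∫ ω, sqLocalDiscrepancy (U ω) (V ω) x ∂P :=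
  integral_integral_swap (integrable_sqLocalDiscrepancy P hU hV)

lemma integral_sqLocalDiscrepancy {Ω : Type*} [MeasurableSpace Ω]
    (P : Measure Ω) [IsProbabilityMeasure P] {U V : Ω → ℝ} (hU : Measurable U) (hV : Measurable V)
    (hindep : IndepFun U V P) (x : ℝ) :
    ∫ ω, sqLocalDiscrepancy (U ω) (V ω) x ∂P =
      (1 / 4 - x) * (P.real {ω | U ω ≤ x} + P.real {ω | V ω ≤ x}) +
        P.real {ω | U ω ≤ x} * P.real {ω | V ω ≤ x} / 2 + x ^ 2 := by
  have hA : MeasurableSet {ω | U ω ≤ x} := measurableSet_le hU measurable_const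
  have hB : MeasurableSet {ω | V ω ≤ x} := measurableSet_le hV measurable_const
  have hAB : P.real ({ω | U ω ≤ x} ∩ {ω | V ω ≤ x}) =
      P.real {ω | U ω ≤ x} * P.real {ω | V ω ≤ x} := by
    have h := hindep.measure_inter_preimage_eq_mul (Set.Iic x) (Set.Iic x)
      measurableSet_Iic measurableSet_Iic
    simpa [measureReal_def, Set.preimage, ENNReal.toReal_mul] using congrArg ENNReal.toReal h
  have hint {S : Set Ω} (hS : MeasurableSet S) : Integrable (S.indicator (1 : Ω → ℝ)) P :=
    (integrable_const (1 : ℝ)).indicator hS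
  have hexp : ∀ ω, sqLocalDiscrepancy (U ω) (V ω) x =
      (1 / 4 - x) * ({ω | U ω ≤ x}.indicator (1 : Ω → ℝ) ω + {ω | V ω ≤ x}.indicator 1 ω) +
        ({ω | U ω ≤ x} ∩ {ω | V ω ≤ x}).indicator 1 ω / 2 + x ^ 2 := by
    intro ω
    by_cases h₁ : U ω ≤ x <;> by_cases h₂ : V ω ≤ x <;>
      simp [sqLocalDiscrepancy, h₁, h₂] <;> ring
  simp_rw [hexp]
  have hsum := ((hint hA).fun_add (hint hB)).const_mul (1 / 4 - x)
  have hinter := (hint (hA.inter hB)).div_const 2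
  rw [integral_add (hsum.fun_add hinter) (integrable_const _), integral_add hsum hinter,
    integral_const_mul, integral_add (hint hA) (hint hB), integral_div,
    integral_indicator_one hA, integral_indicator_one hB, integral_indicator_one (hA.inter hB),
    hAB]
  simp

lemma measureReal_le_of_map_eq_uniform {Ω : Type*} [MeasurableSpace Ω] (P : Measure Ω)
    {Z : Ω → ℝ} (hZ : Measurable Z) (hlaw : Measure.map Z P = volume.restrict (Set.Icc (0 : ℝ) 1))
    {x : ℝ} (hx : x ∈ Set.Icc (0 : ℝ) 1) : P.real {ω | Z ω ≤ x} = x := by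
  have hset : Set.Iic x ∩ Set.Icc 0 1 = Set.Icc 0 x := by
    ext y
    exact ⟨fun h => ⟨h.2.1, h.1⟩, fun h => ⟨h.2, h.1, h.2.trans hx.2⟩⟩
  change (P (Z ⁻¹' Set.Iic x)).toReal = x
  rw [← Measure.map_apply hZ measurableSet_Iic, hlaw, Measure.restrict_apply measurableSet_Iic,
    hset, Real.volume_Icc, sub_zero, ENNReal.toReal_ofReal hx.1]

/-- If `Z₁, Z₂` are i.i.d. uniform on `[0,1]` and `Y₁, Y₂` are independent `[0,1]`-valued
random variables whose cumulative distribution functions satisfy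
`(F_{Y₁}(x) + F_{Y₂}(x))/2 = x` on `[0,1]`, then
`E L2²({Y₁,Y₂}) ≤ E L2²({Z₁,Z₂})`. -/
theorem meanL2sqPair_le_of_cdf_avg {Ω : Type*} [MeasurableSpace Ω]
    (P : Measure Ω) [IsProbabilityMeasure P]
    (Z₁ Z₂ Y₁ Y₂ : Ω → ℝ)
    (hZ₁m : Measurable Z₁) (hZ₂m : Measurable Z₂)
    (hY₁m : Measurable Y₁) (hY₂m : Measurable Y₂)
    (hZindep : IndepFun Z₁ Z₂ P)
    (hZ₁law : Measure.map Z₁ P = volume.restrict (Set.Icc (0 : ℝ) 1))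
    (hZ₂law : Measure.map Z₂ P = volume.restrict (Set.Icc (0 : ℝ) 1))
    (hYindep : IndepFun Y₁ Y₂ P)
    (hY₁range : ∀ ω, Y₁ ω ∈ Set.Icc (0 : ℝ) 1)
    (hY₂range : ∀ ω, Y₂ ω ∈ Set.Icc (0 : ℝ) 1)
    (hcdf : ∀ x ∈ Set.Icc (0 : ℝ) 1,
      ((P {ω | Y₁ ω ≤ x}).toReal + (P {ω | Y₂ ω ≤ x}).toReal) / 2 = x) :
    meanL2sqPair P Y₁ Y₂ ≤ meanL2sqPair P Z₁ Z₂ := by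
  rw [meanL2sqPair_eq_setIntegral_integral P hY₁m hY₂m,
    meanL2sqPair_eq_setIntegral_integral P hZ₁m hZ₂m]
  refine setIntegral_mono_on (integrable_sqLocalDiscrepancy P hY₁m hY₂m).integral_prod_right
    (integrable_sqLocalDiscrepancy P hZ₁m hZ₂m).integral_prod_right measurableSet_Icc
    fun x hx => ?_
  rw [integral_sqLocalDiscrepancy P hY₁m hY₂m hYindep,
    integral_sqLocalDiscrepancy P hZ₁m hZ₂m hZindep,
    measureReal_le_of_map_eq_uniform P hZ₁m hZ₁law hx,
    measureReal_le_of_map_eq_uniform P hZ₂m hZ₂law hx]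
  have hsum : P.real {ω | Y₁ ω ≤ x} + P.real {ω | Y₂ ω ≤ x} = x + x := by
    have h := hcdf x hx
    simp only [measureReal_def]
    linarith
  have hprod : P.real {ω | Y₁ ω ≤ x} * P.real {ω | Y₂ ω ≤ x} ≤ x * x := by
    have hY₂ := eq_sub_of_add_eq' hsum
    rw [hY₂]
    nlinarith [sq_nonneg (P.real {ω | Y₁ ω ≤ x} - x)]
  rw [hsum]
  linarith
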